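/- arXiv:2005.05281 — 2 statements merged into one kernel-verified Lean document; each statement's English description precedes it below -/
import Mathlib

section
/- Let Q : ℤ³ → ℤ² be defined by Q(r₁, r₂, r₃) = (2r₁r₂ + r₂r₃, r₂r₃ + 2r₁r₃). Then the set { v ∈ ℤ³ : Q(v) = 0 } equals the union of the four cyclic subgroups generated by (1,0,0), (0,1,0), (0,0,1) and (1,−2,−2). In particular, every integer solution (r₁, r₂, r₃) of the system 2r₁r₂ + r₂r₃ = 0, r₂r₃ + 2r₁r₃ = 0 lies on one of four lines through the origin. -/
/-- The set of integer solutions of the system `2r₁r₂ + r₂r₃ = 0`, `r₂r₃ + 2r₁r₃ = 0`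
is the union of the four cyclic subgroups of `ℤ³` generated by `(1,0,0)`, `(0,1,0)`,
`(0,0,1)` and `(1,−2,−2)`; in particular every solution lies on one of four lines
through the origin. -/
theorem solutions_eq_union_of_four_lines
    (Q : (Fin 3 → ℤ) → (Fin 2 → ℤ))
    (hQ : ∀ r : Fin 3 → ℤ,
      Q r = ![2 * r 0 * r 1 + r 1 * r 2, r 1 * r 2 + 2 * r 0 * r 2]) :
    {v : Fin 3 → ℤ | Q v = 0} =
      (AddSubgroup.zmultiples (![1, 0, 0] : Fin 3 → ℤ) : Set (Fin 3 → ℤ)) ∪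
      (AddSubgroup.zmultiples (![0, 1, 0] : Fin 3 → ℤ) : Set (Fin 3 → ℤ)) ∪
      (AddSubgroup.zmultiples (![0, 0, 1] : Fin 3 → ℤ) : Set (Fin 3 → ℤ)) ∪
      (AddSubgroup.zmultiples (![1, -2, -2] : Fin 3 → ℤ) : Set (Fin 3 → ℤ)) := by
  ext v
  have mem_iff (w : Fin 3 → ℤ) :
      v ∈ AddSubgroup.zmultiples w ↔
        ∃ k : ℤ, k * w 0 = v 0 ∧ k * w 1 = v 1 ∧ k * w 2 = v 2 := by
    simp [AddSubgroup.mem_zmultiples_iff, funext_iff, Fin.forall_fin_succ]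
  have zero_iff : Q v = 0 ↔
      2 * v 0 * v 1 + v 1 * v 2 = 0 ∧ v 1 * v 2 + 2 * v 0 * v 2 = 0 := by
    simp [hQ, funext_iff, Fin.forall_fin_two]
  simp only [Set.mem_ofPred_eq, Set.mem_union, SetLike.mem_coe, mem_iff, zero_iff,
    Matrix.cons_val]
  constructor
  · rintro ⟨h₁, h₂⟩
    have h₁' : v 1 * (2 * v 0 + v 2) = 0 := by linarith
    have h₂' : v 2 * (v 1 + 2 * v 0) = 0 := by linarith
    rcases mul_eq_zero.mp h₁' with h₁ | h₁ <;> rcases mul_eq_zero.mp h₂' with h₂ | h₂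
    · exact .inl (.inl (.inl ⟨v 0, by omega⟩))
    · exact .inl (.inr ⟨v 2, by omega⟩)
    · exact .inl (.inl (.inr ⟨v 1, by omega⟩))
    · exact .inr ⟨v 0, by omega⟩
  · rintro (((⟨k, h₀, h₁, h₂⟩ | ⟨k, h₀, h₁, h₂⟩) | ⟨k, h₀, h₁, h₂⟩) | ⟨k, h₀, h₁, h₂⟩) <;>
      rw [← h₀, ← h₁, ← h₂] <;> constructor <;> ring
end

section
/- Let Q : ℤ³ → ℤ² be defined by Q(r₁, r₂, r₃) = (2r₁r₂ + r₂r₃, r₂r₃ + 2r₁r₃). Then there do not exist ℤ-linearly independent vectors u, v ∈ ℤ³ such that Q(m·u + n·v) = 0 for all integers m, n. Equivalently, there is no rank-2 subgroup of ℤ³ on which Q vanishes identically; i.e., in the cohomology ring of the 7-manifold of Theorem 5 with a = 1, b = 2, a_{1,1} = a_{1,2} = 1 and h_{1,2} = h_{2,1} = 1, one cannot find a rank-2 submodule of the span of a₁*, b_{1,2}*, b_{2,2}* in H² consisting entirely of elements whose squares vanish. -/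
/-- The two quadratic equations cut out a union of four lines in `ℤ³`. -/
lemma mem_four_lines {a b c : ℤ} (h₁ : 2 * a * b + b * c = 0) (h₂ : b * c + 2 * a * c = 0) :
    (b = 0 ∧ c = 0) ∨ (a = 0 ∧ b = 0) ∨ (a = 0 ∧ c = 0) ∨ (b = -2 * a ∧ c = -2 * a) := by
  have h₁' : b * (2 * a + c) = 0 := by linear_combination h₁
  have h₂' : c * (b + 2 * a) = 0 := by linear_combination h₂
  rcases mul_eq_zero.mp h₁' with h | h <;> rcases mul_eq_zero.mp h₂' with h' | h' <;> omega

/-- There is no rank-2 subgroup of `ℤ³` on which the quadratic map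
`Q(r₁,r₂,r₃) = (2r₁r₂ + r₂r₃, r₂r₃ + 2r₁r₃)` vanishes identically: one cannot find two
`ℤ`-linearly independent vectors all of whose integral linear combinations are solutions. -/
theorem no_rank_two_subgroup_of_solutions
    (Q : (Fin 3 → ℤ) → (Fin 2 → ℤ))
    (hQ : ∀ r : Fin 3 → ℤ,
      Q r = ![2 * r 0 * r 1 + r 1 * r 2, r 1 * r 2 + 2 * r 0 * r 2]) :
    ¬ ∃ u v : Fin 3 → ℤ, LinearIndependent ℤ ![u, v] ∧
      ∀ m n : ℤ, Q (m • u + n • v) = 0 := by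
  rintro ⟨u, v, hli, h⟩
  rw [LinearIndependent.pair_iff] at hli
  have lines : ∀ r : Fin 3 → ℤ, Q r = 0 → (r 1 = 0 ∧ r 2 = 0) ∨ (r 0 = 0 ∧ r 1 = 0) ∨
      (r 0 = 0 ∧ r 2 = 0) ∨ (r 1 = -2 * r 0 ∧ r 2 = -2 * r 0) := by
    intro r hr
    rw [hQ] at hr
    exact mem_four_lines (by simpa using congrFun hr 0) (by simpa using congrFun hr 1)
  have hu := lines u (by simpa using h 1 0)
  have hv := lines v (by simpa using h 0 1)
  have huv := lines (u + v) (by simpa using h 1 1)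
  simp only [Pi.add_apply] at huv
  have cross : ∀ i j : Fin 3, v i * u j = u i * v j := by
    simp only [Fin.forall_fin_succ, Fin.forall_fin_zero]
    rcases hu with ⟨h₁, h₂⟩ | ⟨h₁, h₂⟩ | ⟨h₁, h₂⟩ | ⟨h₁, h₂⟩ <;>
    rcases hv with ⟨h₃, h₄⟩ | ⟨h₃, h₄⟩ | ⟨h₃, h₄⟩ | ⟨h₃, h₄⟩ <;>
    simp [h₁, h₂, h₃, h₄] at huv ⊢ <;> grind
  have hu_zero : u = 0 := by
    ext i
    have := hli (v i) (-u i) (by ext j; simp [cross i j])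
    simpa using this.2
  exact one_ne_zero (hli 1 0 (by simp [hu_zero])).1
end
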